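/- For every point p ∈ 𝓢 there exists a solution c : [0, ∞) → ℝ⁶ of c'(η) = V(c(η)) with c(0) = p and c(η) ∈ 𝓢 for all η ≥ 0; that is, every integral curve of the Einstein vector field starting in 𝓢 is defined for all forward time and remains in 𝓢. -/

import Mathlib

open Real Set Filter

noncomputable section

/-- The quadratic form `G(p) = X₁² + 2X₂² + 4m X₃²`. -/
def G (m : ℕ) (p : Fin 6 → ℝ) : ℝ := (p 0)^2 + 2*(p 1)^2 + 4*(m:ℝ)*(p 2)^2

/-- `R₁(p) = (1/2)Y₁²Y₂² + (m/4)Y₁²Y₃²`. -/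
def R1 (m : ℕ) (p : Fin 6 → ℝ) : ℝ := (1/2)*(p 3)^2*(p 4)^2 + ((m:ℝ)/4)*(p 3)^2*(p 5)^2

/-- `R₂(p) = 2Y₂² − (1/2)Y₁²Y₂² + (m/2)Y₃²`. -/
def R2 (m : ℕ) (p : Fin 6 → ℝ) : ℝ := 2*(p 4)^2 - (1/2)*(p 3)^2*(p 4)^2 + ((m:ℝ)/2)*(p 5)^2

/-- `R₃(p) = (m+2)Y₂Y₃ − (1/8)Y₁²Y₃² − (1/2)Y₃²`. -/
def R3 (m : ℕ) (p : Fin 6 → ℝ) : ℝ :=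
  ((m:ℝ)+2)*(p 4)*(p 5) - (1/8)*(p 3)^2*(p 5)^2 - (1/2)*(p 5)^2

/-- `R_s = R₁ + 2R₂ + 4m R₃`. -/
def Rs (m : ℕ) (p : Fin 6 → ℝ) : ℝ := R1 m p + 2*R2 m p + 4*(m:ℝ)*R3 m p

/-- `L = (G + R_s − 1)/(4m+2)`. -/
def L (m : ℕ) (p : Fin 6 → ℝ) : ℝ := (G m p + Rs m p - 1)/(4*(m:ℝ)+2)

/-- The Einstein vector field. -/
def V (m : ℕ) (p : Fin 6 → ℝ) : Fin 6 → ℝ :=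
  ![ p 0 * (G m p + L m p - 1) + R1 m p - L m p,
     p 1 * (G m p + L m p - 1) + R2 m p - L m p,
     p 2 * (G m p + L m p - 1) + R3 m p - L m p,
     p 3 * (p 0 - p 1),
     p 4 * (G m p + L m p - p 1),
     p 5 * (G m p + L m p + p 1 - 2*p 2) ]

/-- `𝓔 = {p : X₁+2X₂+4m X₃ = 1 and G + R_s ≤ 1}`. -/
def setE (m : ℕ) : Set (Fin 6 → ℝ) :=
  {p | p 0 + 2*p 1 + 4*(m:ℝ)*p 2 = 1 ∧ G m p + Rs m p ≤ 1}

/-- `∂𝓔 = {p : X₁+2X₂+4m X₃ = 1 and G + R_s = 1}`. -/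
def bdryE (m : ℕ) : Set (Fin 6 → ℝ) :=
  {p | p 0 + 2*p 1 + 4*(m:ℝ)*p 2 = 1 ∧ G m p + Rs m p = 1}

/-- `𝓟 = {p : Y₁ ≥ 0, Y₂ ≥ 0, Y₃ ≥ 0}`. -/
def setP : Set (Fin 6 → ℝ) := {p | 0 ≤ p 3 ∧ 0 ≤ p 4 ∧ 0 ≤ p 5}

/-- `𝓐₁ = {p : X₁ ≤ X₂ and Y₁² ≤ 2}`. -/
def setA1 : Set (Fin 6 → ℝ) := {p | p 0 ≤ p 1 ∧ (p 3)^2 ≤ 2}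

/-- `𝓐₂`. -/
def setA2 : Set (Fin 6 → ℝ) :=
  {p | 0 ≤ 2*p 4 - p 5 ∧ 0 ≤ (Real.sqrt 2/2)*(2*p 4 - p 5) + p 2 - p 1 ∧
       p 1 ≤ 1/2 ∧ 0 ≤ p 2}

/-- The compact invariant set `𝓢`. -/
def setS (m : ℕ) : Set (Fin 6 → ℝ) := setE m ∩ setP ∩ setA1 ∩ setA2

/-- A solution of the Einstein ODE system on a set `I ⊆ ℝ`. -/
def IsSolution (m : ℕ) (I : Set ℝ) (c : ℝ → Fin 6 → ℝ) : Prop :=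
  ∀ η ∈ I, HasDerivWithinAt c (V m (c η)) I η

open scoped NNReal

/-- A bounded Lipschitz autonomous vector field on a Banach space has global integral curves. -/
theorem exists_forall_hasDerivAt_of_lipschitzWith {E : Type*} [NormedAddCommGroup E]
    [NormedSpace ℝ E] [CompleteSpace E] {W : E → E} {K M : ℝ≥0} (hW : LipschitzWith K W)
    (hM : ∀ x, ‖W x‖ ≤ M) (x : E) :
    ∃ c : ℝ → E, c 0 = x ∧ ∀ t, HasDerivAt c (W (c t)) t := by
  have local_solution : ∀ T : ℝ, 0 < T → ∃ c : ℝ → E, c 0 = x ∧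
      ∀ t ∈ Ioo (-T) T, HasDerivAt c (W (c t)) t := by
    intro T hT
    have hPL : IsPicardLindelof (fun _ ↦ W)
        (⟨0, by constructor <;> linarith⟩ : Icc (-T) T) x (M * T.toNNReal) 0 M K :=
      { lipschitzOnWith := fun _ _ ↦ hW.lipschitzOnWith
        continuousOn := fun _ _ ↦ continuousOn_const
        norm_le := fun _ _ y _ ↦ hM y
        mul_max_le := by simp [hT.le] }
    obtain ⟨c, hc0, hc⟩ := hPL.exists_eq_forall_mem_Icc_hasDerivWithinAt₀
    exact ⟨c, hc0, fun t ht ↦ (hc t (Ioo_subset_Icc_self ht)).hasDerivAt (Icc_mem_nhds ht.1 ht.2)⟩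
  choose γ hγ0 hγ using fun T : {T : ℝ // 0 < T} ↦ local_solution T T.2
  have agree : ∀ (S T : {T : ℝ // 0 < T}) (t : ℝ), |t| < S → |t| < T → γ S t = γ T t := by
    intro S T t hS hT
    have hm : 0 < min S.1 T.1 := lt_min S.2 T.2
    refine ODE_solution_unique_of_mem_Ioo (v := fun _ ↦ W) (s := fun _ ↦ univ) (K := K) (t₀ := 0)
      (a := -min S.1 T.1) (b := min S.1 T.1) (fun _ _ ↦ hW.lipschitzOnWith)
      ⟨by linarith, hm⟩ (fun u hu ↦ ⟨hγ S u ?_, mem_univ _⟩)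
      (fun u hu ↦ ⟨hγ T u ?_, mem_univ _⟩) (by rw [hγ0, hγ0]) (abs_lt.1 (lt_min hS hT))
    · exact abs_lt.1 ((abs_lt.2 hu).trans_le (min_le_left _ _))
    · exact abs_lt.1 ((abs_lt.2 hu).trans_le (min_le_right _ _))
  refine ⟨fun t ↦ γ ⟨|t| + 1, by positivity⟩ t, hγ0 _, fun t ↦ ?_⟩
  have hlt : |t| < |t| + 1 := lt_add_one _
  refine (hγ ⟨|t| + 1, by positivity⟩ t (abs_lt.1 hlt)).congr_of_eventuallyEq ?_
  filter_upwards [continuous_abs.continuousAt.eventually_lt continuousAt_const hlt] with u hu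
  exact agree _ _ u (lt_add_one _) hu

/-- Variation of constants for a scalar linear differential inequality. -/
theorem mul_exp_integral_le_of_hasDerivAt {z z' a : ℝ → ℝ} {T : ℝ} (hT : 0 ≤ T)
    (ha : Continuous a) (hz : ∀ t, HasDerivAt z (z' t) t)
    (hb : ∀ t ∈ Icc 0 T, a t * z t ≤ z' t) :
    z 0 * Real.exp (∫ s in 0..T, a s) ≤ z T := by
  have hA : ∀ t, HasDerivAt (fun t ↦ ∫ s in 0..t, a s) (a t) t := fun t ↦
    intervalIntegral.integral_hasDerivAt_right (ha.intervalIntegrable _ _)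
      (ha.stronglyMeasurableAtFilter _ _) ha.continuousAt
  have hd : ∀ t, HasDerivAt (fun t ↦ z t * Real.exp (-∫ s in 0..t, a s))
      (z' t * Real.exp (-∫ s in 0..t, a s)
        + z t * (Real.exp (-∫ s in 0..t, a s) * -a t)) t :=
    fun t ↦ (hz t).mul (hA t).neg.exp
  have hmono : MonotoneOn (fun t ↦ z t * Real.exp (-∫ s in 0..t, a s)) (Icc 0 T) := by
    refine monotoneOn_of_deriv_nonneg (convex_Icc 0 T)
      (fun t _ ↦ (hd t).continuousAt.continuousWithinAt)
      (fun t _ ↦ (hd t).differentiableAt.differentiableWithinAt) fun t ht ↦ ?_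
    rw [(hd t).deriv]
    have h1 := hb t (interior_subset ht)
    have h2 := mul_nonneg (sub_nonneg.2 h1) (Real.exp_pos (-∫ s in 0..t, a s)).le
    linarith
  have h := hmono ⟨le_rfl, hT⟩ ⟨hT, le_rfl⟩ hT
  simp only [intervalIntegral.integral_same, neg_zero, Real.exp_zero, mul_one] at h
  rwa [Real.exp_neg, ← div_eq_mul_inv, le_div_iff₀ (Real.exp_pos _)] at h

theorem nonneg_of_hasDerivAt_ge {z z' a : ℝ → ℝ} {T : ℝ} (hT : 0 ≤ T)
    (ha : Continuous a) (hz : ∀ t, HasDerivAt z (z' t) t)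
    (hb : ∀ t ∈ Icc 0 T, a t * z t ≤ z' t) (h0 : 0 ≤ z 0) : 0 ≤ z T :=
  (mul_nonneg h0 (Real.exp_pos _).le).trans (mul_exp_integral_le_of_hasDerivAt hT ha hz hb)

theorem pos_of_hasDerivAt_ge {z z' a : ℝ → ℝ} {T : ℝ} (hT : 0 ≤ T)
    (ha : Continuous a) (hz : ∀ t, HasDerivAt z (z' t) t)
    (hb : ∀ t ∈ Icc 0 T, a t * z t ≤ z' t) (h0 : 0 < z 0) : 0 < z T :=
  (mul_pos h0 (Real.exp_pos _)).trans_le (mul_exp_integral_le_of_hasDerivAt hT ha hz hb)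

theorem eq_zero_of_hasDerivAt_linear {z a : ℝ → ℝ} {T : ℝ} (hT : 0 ≤ T)
    (ha : Continuous a) (hz : ∀ t, HasDerivAt z (a t * z t) t) (h0 : z 0 = 0) : z T = 0 := by
  refine le_antisymm ?_ (nonneg_of_hasDerivAt_ge hT ha hz (fun t _ ↦ le_rfl) h0.ge)
  have h := nonneg_of_hasDerivAt_ge (z := fun t ↦ -z t) hT ha (fun t ↦ (hz t).neg)
    (fun t _ ↦ by linarith) (by simp [h0])
  linarith

theorem hasDerivAt_sq_min_zero (x : ℝ) :
    HasDerivAt (fun x : ℝ ↦ (min x 0) ^ 2) (2 * min x 0) x := by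
  rcases lt_trichotomy x 0 with hx | rfl | hx
  · rw [min_eq_left hx.le]
    refine ((hasDerivAt_pow 2 x).congr_of_eventuallyEq ?_).congr_deriv (by simp)
    filter_upwards [Iio_mem_nhds hx] with y hy
    rw [min_eq_left (le_of_lt hy)]
  · rw [hasDerivAt_iff_isLittleO_nhds_zero]
    have hO : (fun h : ℝ ↦ min (0 + h) 0 ^ 2 - min (0 : ℝ) 0 ^ 2 - h • (2 * min (0 : ℝ) 0))
        =O[nhds 0] fun h : ℝ ↦ h ^ 2 := by
      refine Asymptotics.IsBigO.of_bound 1 (Eventually.of_forall fun h ↦ ?_)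
      rcases le_total h 0 with hh | hh <;> simp [hh]
    exact hO.trans_isLittleO (Asymptotics.isLittleO_pow_id one_lt_two)
  · rw [min_eq_right hx.le, mul_zero]
    refine (hasDerivAt_const x (0 : ℝ)).congr_of_eventuallyEq ?_
    filter_upwards [Ioi_mem_nhds hx] with y hy
    simp [min_eq_right (le_of_lt (mem_Ioi.1 hy))]

/-- A cooperative planar linear system preserves the closed first quadrant. -/
theorem nonneg_of_hasDerivAt_cooperative {x y a b c d : ℝ → ℝ} {T : ℝ} (hT : 0 ≤ T)
    (ha : Continuous a) (hb : Continuous b) (hc : Continuous c) (hd : Continuous d)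
    (hx : ∀ t, HasDerivAt x (a t * x t + b t * y t) t)
    (hy : ∀ t, HasDerivAt y (c t * x t + d t * y t) t)
    (hb0 : ∀ t ∈ Icc 0 T, 0 ≤ b t) (hc0 : ∀ t ∈ Icc 0 T, 0 ≤ c t)
    (hx0 : 0 ≤ x 0) (hy0 : 0 ≤ y 0) : 0 ≤ x T ∧ 0 ≤ y T := by
  have hz : ∀ t, HasDerivAt (fun t ↦ -(min (x t) 0 ^ 2 + min (y t) 0 ^ 2))
      (-(2 * min (x t) 0 * (a t * x t + b t * y t)
        + 2 * min (y t) 0 * (c t * x t + d t * y t))) t := fun t ↦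
    (((hasDerivAt_sq_min_zero (x t)).comp t (hx t)).add
      ((hasDerivAt_sq_min_zero (y t)).comp t (hy t))).neg
  have key := nonneg_of_hasDerivAt_ge
    (a := fun t ↦ 2 * |a t| + 2 * |d t| + |b t| + |c t|) hT (by fun_prop) hz ?_
    (by simp [hx0, hy0])
  · have h1 : min (x T) 0 = 0 := by nlinarith [sq_nonneg (min (x T) 0), sq_nonneg (min (y T) 0)]
    have h2 : min (y T) 0 = 0 := by nlinarith [sq_nonneg (min (x T) 0), sq_nonneg (min (y T) 0)]
    exact ⟨min_eq_right_iff.1 h1, min_eq_right_iff.1 h2⟩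
  intro t ht
  have hbt := hb0 t ht
  have hct := hc0 t ht
  have hsq : ∀ u : ℝ, min u 0 * u = min u 0 ^ 2 := by
    intro u; rcases le_total u 0 with h | h <;> simp [h, sq]
  have hcross : ∀ u v : ℝ, 2 * (min u 0 * v) ≤ min u 0 ^ 2 + min v 0 ^ 2 := by
    intro u v
    nlinarith [mul_nonneg_of_nonpos_of_nonpos (min_le_right u 0) (sub_nonpos.2 (min_le_left v 0)),
      sq_nonneg (min u 0 - min v 0)]
  have e1 := hsq (x t)
  have e2 := hsq (y t)
  have h1 := mul_le_mul_of_nonneg_left (hcross (x t) (y t)) hbt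
  have h2 := mul_le_mul_of_nonneg_left (hcross (y t) (x t)) hct
  have h3 := mul_le_mul_of_nonneg_right (le_abs_self (a t)) (sq_nonneg (min (x t) 0))
  have h4 := mul_le_mul_of_nonneg_right (le_abs_self (d t)) (sq_nonneg (min (y t) 0))
  have h5 := mul_nonneg (abs_nonneg (a t)) (sq_nonneg (min (y t) 0))
  have h6 := mul_nonneg (abs_nonneg (d t)) (sq_nonneg (min (x t) 0))
  rw [abs_of_nonneg hbt, abs_of_nonneg hct]
  generalize min (x t) 0 = p at *
  generalize min (y t) 0 = q at *
  have : 2 * p * (a t * x t + b t * y t) + 2 * q * (c t * x t + d t * y t)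
      = 2 * a t * (p * x t) + b t * (2 * (p * y t)) + c t * (2 * (q * x t))
        + 2 * d t * (q * y t) := by ring
  rw [this, e1, e2]
  linarith

section Curve

variable {m : ℕ} {c : ℝ → Fin 6 → ℝ} {θ : ℝ → ℝ}

theorem mul_L (m : ℕ) (p : Fin 6 → ℝ) : (4 * (m : ℝ) + 2) * L m p = G m p + Rs m p - 1 := by
  unfold L
  field_simp

theorem continuous_G (m : ℕ) : Continuous (G m) := by
  unfold G; fun_prop

theorem continuous_L (m : ℕ) : Continuous (L m) := by
  unfold L G Rs R1 R2 R3; fun_prop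

theorem contDiff_V (m : ℕ) : ContDiff ℝ 1 (V m) := by
  rw [contDiff_pi]
  intro i
  fin_cases i <;> simp [V, L, G, Rs, R1, R2, R3] <;> fun_prop

theorem hasDerivAt_coord (hc : ∀ t, HasDerivAt c (θ t • V m (c t)) t) (i : Fin 6) (t : ℝ) :
    HasDerivAt (fun t ↦ c t i) (θ t * V m (c t) i) t :=
  hasDerivAt_pi.1 (hc t) i

theorem hasDerivAt_trace (hc : ∀ t, HasDerivAt c (θ t • V m (c t)) t) (t : ℝ) :
    HasDerivAt (fun t ↦ c t 0 + 2 * c t 1 + 4 * (m : ℝ) * c t 2 - 1)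
      (θ t * (G m (c t) + L m (c t) - 1)
        * (c t 0 + 2 * c t 1 + 4 * (m : ℝ) * c t 2 - 1)) t := by
  have h := hasDerivAt_coord hc
  refine ((((h 0 t).add ((h 1 t).const_mul 2)).add
    ((h 2 t).const_mul (4 * (m : ℝ)))).sub_const 1).congr_deriv ?_
  have hL := mul_L m (c t)
  simp only [V, Rs] at hL ⊢
  simp only [Matrix.cons_val]
  linear_combination -θ t * hL

theorem hasDerivAt_G (hc : ∀ t, HasDerivAt c (θ t • V m (c t)) t) (t : ℝ) :
    HasDerivAt (fun t ↦ G m (c t))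
      (θ t * (2 * (G m (c t) * (G m (c t) + L m (c t) - 1)
        + (c t 0 * R1 m (c t) + 2 * c t 1 * R2 m (c t) + 4 * (m : ℝ) * c t 2 * R3 m (c t))
        - L m (c t) * (c t 0 + 2 * c t 1 + 4 * (m : ℝ) * c t 2)))) t := by
  have h := hasDerivAt_coord hc
  refine ((((h 0 t).pow 2).add (((h 1 t).pow 2).const_mul 2)).add
    (((h 2 t).pow 2).const_mul (4 * (m : ℝ)))).congr_deriv ?_
  simp only [V, Matrix.cons_val]
  generalize hg : G m (c t) = g
  have hg' := hg
  simp only [G] at hg'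
  push_cast
  linear_combination -2 * θ t * (g + L m (c t) - 1) * (-hg')

theorem hasDerivAt_Rs (hc : ∀ t, HasDerivAt c (θ t • V m (c t)) t) (t : ℝ) :
    HasDerivAt (fun t ↦ Rs m (c t))
      (θ t * (2 * (G m (c t) + L m (c t)) * Rs m (c t)
        - 2 * (c t 0 * R1 m (c t) + 2 * c t 1 * R2 m (c t)
          + 4 * (m : ℝ) * c t 2 * R3 m (c t)))) t := by
  have h3 := hasDerivAt_coord hc 3 t
  have h4 := hasDerivAt_coord hc 4 t
  have h5 := hasDerivAt_coord hc 5 t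
  have d1 := ((((h3.pow 2).const_mul (1 / 2)).mul (h4.pow 2)).add
    (((h3.pow 2).const_mul ((m : ℝ) / 4)).mul (h5.pow 2)))
  have d2 := (((h4.pow 2).const_mul 2).sub (((h3.pow 2).const_mul (1 / 2)).mul (h4.pow 2))).add
    ((h5.pow 2).const_mul ((m : ℝ) / 2))
  have d3 := (((h4.const_mul ((m : ℝ) + 2)).mul h5).sub
    (((h3.pow 2).const_mul (1 / 8)).mul (h5.pow 2))).sub ((h5.pow 2).const_mul (1 / 2))
  refine ((d1.add (d2.const_mul 2)).add (d3.const_mul (4 * (m : ℝ)))).congr_deriv ?_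
  simp only [V, Matrix.cons_val, Pi.pow_apply]
  simp only [Rs, R1, R2, R3]
  generalize G m (c t) = g
  generalize L m (c t) = l
  push_cast
  ring

theorem hasDerivAt_constraint (hc : ∀ t, HasDerivAt c (θ t • V m (c t)) t) (t : ℝ) :
    HasDerivAt (fun t ↦ 1 - (G m (c t) + Rs m (c t)))
      (θ t * (2 * (G m (c t) + L m (c t))) * (1 - (G m (c t) + Rs m (c t)))
        + 2 * θ t * L m (c t) * (c t 0 + 2 * c t 1 + 4 * (m : ℝ) * c t 2 - 1)) t := by
  refine (((hasDerivAt_G hc t).add (hasDerivAt_Rs hc t)).const_sub 1).congr_deriv ?_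
  ring

/-- The factor coupling `2Y₂ - Y₃` into the evolution of `(√2/2)(2Y₂ - Y₃) + X₃ - X₂`. -/
def coupling (m : ℕ) (p : Fin 6 → ℝ) : ℝ :=
  Real.sqrt 2 / 2 * (1 - p 1) - p 4 + ((m : ℝ) - 1) / 2 * p 5
    + (p 3) ^ 2 / 8 * (2 * p 4 + p 5)

/-- The defining function `(√2/2)(2Y₂ - Y₃) + X₃ - X₂` of `𝓐₂`. -/
def gap (p : Fin 6 → ℝ) : ℝ := Real.sqrt 2 / 2 * (2 * p 4 - p 5) + p 2 - p 1

theorem hasDerivAt_two_mul_sub (hc : ∀ t, HasDerivAt c (θ t • V m (c t)) t) (t : ℝ) :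
    HasDerivAt (fun t ↦ 2 * c t 4 - c t 5)
      (θ t * (G m (c t) + L m (c t) - c t 1 - Real.sqrt 2 * c t 5) * (2 * c t 4 - c t 5)
        + θ t * (2 * c t 5) * gap (c t)) t := by
  have h := hasDerivAt_coord hc
  refine (((h 4 t).const_mul 2).sub (h 5 t)).congr_deriv ?_
  simp only [V, Matrix.cons_val, gap]
  ring

theorem hasDerivAt_gap (hc : ∀ t, HasDerivAt c (θ t • V m (c t)) t) (t : ℝ) :
    HasDerivAt (fun t ↦ gap (c t))
      (θ t * coupling m (c t) * (2 * c t 4 - c t 5)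
        + θ t * (G m (c t) + L m (c t) - 1 + Real.sqrt 2 * c t 5) * gap (c t)) t := by
  have h := hasDerivAt_coord hc
  refine ((((((h 4 t).const_mul 2).sub (h 5 t)).const_mul (Real.sqrt 2 / 2)).add
    (h 2 t)).sub (h 1 t)).congr_deriv ?_
  have hs : Real.sqrt 2 ^ 2 = 2 := Real.sq_sqrt (by norm_num)
  simp only [V, Matrix.cons_val, gap, coupling, R2, R3]
  linear_combination (-(θ t * c t 5 * (2 * c t 4 - c t 5)) / 2) * hs

theorem R1_nonneg (m : ℕ) (p : Fin 6 → ℝ) : 0 ≤ R1 m p := by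
  unfold R1; positivity

theorem R3_nonneg (hm : 1 ≤ m) {p : Fin 6 → ℝ} (hp : p ∈ setP) (h3 : (p 3) ^ 2 ≤ 2)
    (h : p 5 ≤ 4 * p 4) : 0 ≤ R3 m p := by
  obtain ⟨-, h4, h5⟩ := hp
  have hm' : (1 : ℝ) ≤ m := by exact_mod_cast hm
  have e : R3 m p = p 5 * (((m : ℝ) - 1) * p 4 + 3 / 4 * (4 * p 4 - p 5)
      + (2 - (p 3) ^ 2) / 8 * p 5) := by unfold R3; ring
  rw [e]
  have := sub_nonneg.2 hm'
  have := sub_nonneg.2 h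
  have := sub_nonneg.2 h3
  positivity

theorem le_Rs (hm : 1 ≤ m) {p : Fin 6 → ℝ} (hp : p ∈ setP) (h3 : (p 3) ^ 2 ≤ 2)
    (h : p 5 ≤ 4 * p 4) : (4 - (p 3) ^ 2 / 2) * (p 4) ^ 2 ≤ Rs m p := by
  obtain ⟨-, h4, h5⟩ := hp
  have hm' : (1 : ℝ) ≤ m := by exact_mod_cast hm
  have e : Rs m p = (4 - (p 3) ^ 2 / 2) * (p 4) ^ 2
      + m * p 5 * (4 * ((m : ℝ) - 1) * p 4 + 6 * p 4 + 3 / 2 * (4 * p 4 - p 5)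
        + (2 - (p 3) ^ 2) / 4 * p 5) := by unfold Rs R1 R2 R3; ring
  rw [e]
  have := sub_nonneg.2 hm'
  have := sub_nonneg.2 h
  have := sub_nonneg.2 h3
  have : 0 ≤ (m : ℝ) * p 5 * (4 * ((m : ℝ) - 1) * p 4 + 6 * p 4 + 3 / 2 * (4 * p 4 - p 5)
        + (2 - (p 3) ^ 2) / 4 * p 5) := by positivity
  linarith

theorem coupling_nonneg (hm : 1 ≤ m) {p : Fin 6 → ℝ} (hp : p ∈ setP) (h3 : (p 3) ^ 2 ≤ 2)
    (h : p 5 ≤ 4 * p 4) (hE : G m p + Rs m p ≤ 1) (h1 : p 1 ≤ 1 / 2) : 0 ≤ coupling m p := by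
  have hRs := le_Rs hm hp h3 h
  obtain ⟨-, h4, h5⟩ := hp
  have hm' : (1 : ℝ) ≤ m := by exact_mod_cast hm
  have hG : 2 * (p 1) ^ 2 ≤ G m p := by
    unfold G; nlinarith [sq_nonneg (p 0), mul_nonneg (zero_le_one.trans hm') (sq_nonneg (p 2))]
  have hs : Real.sqrt 2 ^ 2 = 2 := Real.sq_sqrt (by norm_num)
  have key : (1 - (p 3) ^ 2 / 4) * p 4 ≤ Real.sqrt 2 / 2 * (1 - p 1) := by
    refine le_of_sq_le_sq ?_ (mul_nonneg (by positivity) (by linarith))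
    have hy := sq_nonneg (p 4)
    have e1 : ((1 - (p 3) ^ 2 / 4) * p 4) ^ 2
        = (4 - (p 3) ^ 2 / 2) * (p 4) ^ 2 / 4 - (p 3) ^ 2 / 16 * (6 - (p 3) ^ 2) * (p 4) ^ 2 := by
      ring
    have e2 : (Real.sqrt 2 / 2 * (1 - p 1)) ^ 2 = (1 - p 1) ^ 2 / 2 := by
      linear_combination (1 - p 1) ^ 2 / 4 * hs
    have : 0 ≤ (p 3) ^ 2 / 16 * (6 - (p 3) ^ 2) * (p 4) ^ 2 :=
      mul_nonneg (mul_nonneg (by positivity) (by linarith)) hy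
    rw [e1, e2]
    nlinarith [sq_nonneg (1 - 2 * p 1)]
  have : 0 ≤ ((m : ℝ) - 1) / 2 * p 5 := mul_nonneg (by linarith) h5
  have : 0 ≤ (p 3) ^ 2 / 8 * p 5 := by positivity
  unfold coupling
  linarith

theorem mem_setE_inter_setP_inter_setA1_of_hasDerivAt (hθ : Continuous θ)
    (hθ0 : ∀ t, 0 ≤ θ t) (hc : ∀ t, HasDerivAt c (θ t • V m (c t)) t)
    (h0 : c 0 ∈ setE m ∩ setP ∩ setA1) {T : ℝ} (hT : 0 ≤ T) :
    c T ∈ setE m ∩ setP ∩ setA1 := by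
  obtain ⟨⟨⟨hH0, hQ0⟩, h30, h40, h50⟩, hw0, hu0⟩ := h0
  have hcc : Continuous c := continuous_iff_continuousAt.2 fun t ↦ (hc t).continuousAt
  have hGc : Continuous fun t ↦ G m (c t) := (continuous_G m).comp hcc
  have hLc : Continuous fun t ↦ L m (c t) := (continuous_L m).comp hcc
  have h := hasDerivAt_coord hc
  have hH : ∀ t, 0 ≤ t → c t 0 + 2 * c t 1 + 4 * (m : ℝ) * c t 2 - 1 = 0 := fun t ht ↦
    eq_zero_of_hasDerivAt_linear (z := fun t ↦ c t 0 + 2 * c t 1 + 4 * (m : ℝ) * c t 2 - 1)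
      (a := fun t ↦ θ t * (G m (c t) + L m (c t) - 1)) ht (by fun_prop)
      (hasDerivAt_trace hc) (sub_eq_zero.2 hH0)
  have hQ := nonneg_of_hasDerivAt_ge (a := fun t ↦ θ t * (2 * (G m (c t) + L m (c t)))) hT
    (by fun_prop) (hasDerivAt_constraint hc) (fun t ht ↦ by rw [hH t ht.1]; simp)
    (sub_nonneg.2 hQ0)
  have h3 : 0 ≤ c T 3 := nonneg_of_hasDerivAt_ge (a := fun t ↦ θ t * (c t 0 - c t 1)) hT
    (by fun_prop) (h 3) (fun t _ ↦ le_of_eq (by simp only [V, Matrix.cons_val]; ring)) h30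
  have h4 : 0 ≤ c T 4 := nonneg_of_hasDerivAt_ge
    (a := fun t ↦ θ t * (G m (c t) + L m (c t) - c t 1)) hT
    (by fun_prop) (h 4) (fun t _ ↦ le_of_eq (by simp only [V, Matrix.cons_val]; ring)) h40
  have h5 : 0 ≤ c T 5 := nonneg_of_hasDerivAt_ge
    (a := fun t ↦ θ t * (G m (c t) + L m (c t) + c t 1 - 2 * c t 2)) hT
    (by fun_prop) (h 5) (fun t _ ↦ le_of_eq (by simp only [V, Matrix.cons_val]; ring)) h50
  obtain ⟨hw, hu⟩ := nonneg_of_hasDerivAt_cooperative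
    (x := fun t ↦ c t 1 - c t 0) (y := fun t ↦ 2 - c t 3 ^ 2)
    (a := fun t ↦ θ t * (G m (c t) + L m (c t) - 1))
    (b := fun t ↦ θ t * (c t 4 ^ 2 + (m : ℝ) / 4 * c t 5 ^ 2))
    (c := fun t ↦ θ t * (2 * c t 3 ^ 2)) (d := fun _ ↦ 0) hT
    (by fun_prop) (by fun_prop) (by fun_prop) (by fun_prop)
    (fun t ↦ ((h 1 t).sub (h 0 t)).congr_deriv
      (by simp only [V, Matrix.cons_val, R1, R2]; ring))
    (fun t ↦ (((h 3 t).pow 2).const_sub 2).congr_deriv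
      (by simp only [V, Matrix.cons_val]; push_cast; ring))
    (fun t _ ↦ mul_nonneg (hθ0 t) (by positivity))
    (fun t _ ↦ mul_nonneg (hθ0 t) (by positivity)) (sub_nonneg.2 hw0) (sub_nonneg.2 hu0)
  exact ⟨⟨⟨sub_eq_zero.1 (hH T hT), sub_nonneg.1 hQ⟩, h3, h4, h5⟩, sub_nonneg.1 hw,
    sub_nonneg.1 hu⟩

/-- The conditions defining `𝓐₂` persist as long as `Y₃ ≤ 4Y₂`. -/
theorem mem_setA2_of_hasDerivAt (hm : 1 ≤ m) (hθ : Continuous θ)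
    (hθ0 : ∀ t, 0 ≤ θ t) (hc : ∀ t, HasDerivAt c (θ t • V m (c t)) t)
    (h0 : c 0 ∈ setS m) {T : ℝ} (hT : 0 ≤ T) (hY : ∀ t ∈ Icc 0 T, c t 5 ≤ 4 * c t 4) :
    c T ∈ setA2 := by
  have hcc : Continuous c := continuous_iff_continuousAt.2 fun t ↦ (hc t).continuousAt
  have hGc : Continuous fun t ↦ G m (c t) := (continuous_G m).comp hcc
  have hLc : Continuous fun t ↦ L m (c t) := (continuous_L m).comp hcc
  have h := hasDerivAt_coord hc
  have hEPA : ∀ t, 0 ≤ t → c t ∈ setE m ∩ setP ∩ setA1 := fun t ht ↦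
    mem_setE_inter_setP_inter_setA1_of_hasDerivAt hθ hθ0 hc h0.1 ht
  obtain ⟨-, hf0, hg0, hk0, hx0⟩ := h0
  have hR3 : ∀ t ∈ Icc 0 T, 0 ≤ R3 m (c t) := fun t ht ↦
    R3_nonneg hm (hEPA t ht.1).1.2 (hEPA t ht.1).2.2 (hY t ht)
  have hL : ∀ t, 0 ≤ t → L m (c t) ≤ 0 := fun t ht ↦
    div_nonpos_of_nonpos_of_nonneg (by linarith [(hEPA t ht).1.1.2]) (by positivity)
  have hX2 : ∀ t ∈ Icc 0 T, 0 ≤ 1 / 2 - c t 1 := by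
    intro t ht
    refine nonneg_of_hasDerivAt_ge (z := fun t ↦ 1 / 2 - c t 1)
      (a := fun t ↦ θ t * (G m (c t) + L m (c t) - 1)) ht.1
      (by fun_prop) (fun t ↦ (h 1 t).const_sub (1 / 2)) (fun s hs ↦ ?_) (sub_nonneg.2 hk0)
    have hr1 := R1_nonneg m (c s)
    have hr3 := mul_nonneg (Nat.cast_nonneg (α := ℝ) m) (hR3 s ⟨hs.1, hs.2.trans ht.2⟩)
    have hl : 0 ≤ (4 * (m : ℝ) + 1) * -L m (c s) :=
      mul_nonneg (by positivity) (neg_nonneg.2 (hL s hs.1))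
    have hml := mul_L m (c s)
    have key : 0 ≤ θ s * ((R1 m (c s) + 4 * (m * R3 m (c s))
        + (4 * (m : ℝ) + 1) * -L m (c s)) / 2) := mul_nonneg (hθ0 s) (by positivity)
    simp only [V, Matrix.cons_val]
    rw [Rs] at hml
    linear_combination key - θ s / 2 * hml
  have hX3 : 0 ≤ c T 2 := by
    refine nonneg_of_hasDerivAt_ge
      (a := fun t ↦ θ t * (G m (c t) + L m (c t) - 1)) hT
      (by fun_prop) (h 2) (fun s hs ↦ ?_) hx0
    have key := mul_nonneg (hθ0 s) (add_nonneg (hR3 s hs) (neg_nonneg.2 (hL s hs.1)))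
    simp only [V, Matrix.cons_val]
    linear_combination key
  obtain ⟨hf, hg⟩ := nonneg_of_hasDerivAt_cooperative hT (b := fun t ↦ θ t * (2 * c t 5))
    (a := fun t ↦ θ t * (G m (c t) + L m (c t) - c t 1 - Real.sqrt 2 * c t 5))
    (c := fun t ↦ θ t * coupling m (c t))
    (d := fun t ↦ θ t * (G m (c t) + L m (c t) - 1 + Real.sqrt 2 * c t 5))
    (by fun_prop) (by fun_prop) (by unfold coupling; fun_prop) (by fun_prop)
    (hasDerivAt_two_mul_sub hc) (hasDerivAt_gap hc)
    (fun t ht ↦ mul_nonneg (hθ0 t) (mul_nonneg zero_le_two (hEPA t ht.1).1.2.2.2))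
    (fun t ht ↦ mul_nonneg (hθ0 t) (coupling_nonneg hm (hEPA t ht.1).1.2 (hEPA t ht.1).2.2
      (hY t ht) (hEPA t ht.1).1.1.2 (sub_nonneg.1 (hX2 t ht)))) hf0 hg0
  exact ⟨hf, hg, sub_nonneg.1 (hX2 T ⟨hT, le_rfl⟩), hX3⟩

theorem mem_setS_of_hasDerivAt (hm : 1 ≤ m) (hθ : Continuous θ)
    (hθ0 : ∀ t, 0 ≤ θ t) (hc : ∀ t, HasDerivAt c (θ t • V m (c t)) t)
    (h0 : c 0 ∈ setS m) {T : ℝ} (hT : 0 ≤ T) : c T ∈ setS m := by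
  have hcc : Continuous c := continuous_iff_continuousAt.2 fun t ↦ (hc t).continuousAt
  have hGc : Continuous fun t ↦ G m (c t) := (continuous_G m).comp hcc
  have hLc : Continuous fun t ↦ L m (c t) := (continuous_L m).comp hcc
  have h := hasDerivAt_coord hc
  refine ⟨mem_setE_inter_setP_inter_setA1_of_hasDerivAt hθ hθ0 hc h0.1 hT,
    mem_setA2_of_hasDerivAt hm hθ hθ0 hc h0 hT ?_⟩
  have h40 : 0 ≤ c 0 4 := h0.1.1.2.2.1
  have hf0 : 0 ≤ 2 * c 0 4 - c 0 5 := h0.2.1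
  have d4 : ∀ t, HasDerivAt (fun t ↦ c t 4)
      (θ t * (G m (c t) + L m (c t) - c t 1) * c t 4) t := fun t ↦
    (h 4 t).congr_deriv (by simp only [V, Matrix.cons_val]; ring)
  have d5 : ∀ t, HasDerivAt (fun t ↦ c t 5)
      (θ t * (G m (c t) + L m (c t) + c t 1 - 2 * c t 2) * c t 5) t := fun t ↦
    (h 5 t).congr_deriv (by simp only [V, Matrix.cons_val]; ring)
  rcases h40.eq_or_lt with h4 | h4
  · have h5 : c 0 5 = 0 := le_antisymm (by linarith) h0.1.1.2.2.2
    intro t ht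
    have e4 : c t 4 = 0 := eq_zero_of_hasDerivAt_linear
      (a := fun t ↦ θ t * (G m (c t) + L m (c t) - c t 1)) ht.1 (by fun_prop) d4 h4.symm
    have e5 : c t 5 = 0 := eq_zero_of_hasDerivAt_linear
      (a := fun t ↦ θ t * (G m (c t) + L m (c t) + c t 1 - 2 * c t 2)) ht.1
      (by fun_prop) d5 h5
    simp [e4, e5]
  · by_contra! hbad
    obtain ⟨u, hu, hu5⟩ := hbad
    have hK : IsCompact (Icc 0 T ∩ {t | 4 * c t 4 ≤ c t 5}) :=
      isCompact_Icc.inter_right (isClosed_le (by fun_prop) (by fun_prop))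
    obtain ⟨τ, ⟨hτ, hτ5⟩, hleast⟩ := hK.exists_isLeast ⟨u, hu, hu5.le⟩
    have hbefore : ∀ t ∈ Ico 0 τ, c t 5 ≤ 4 * c t 4 := fun t ht ↦ by
      by_contra! hlt
      exact absurd (hleast ⟨⟨ht.1, ht.2.le.trans hτ.2⟩, hlt.le⟩) (not_le.2 ht.2)
    have hpos : 0 < c τ 4 := pos_of_hasDerivAt_ge
      (a := fun t ↦ θ t * (G m (c t) + L m (c t) - c t 1)) hτ.1 (by fun_prop) d4
      (fun _ _ ↦ le_rfl) h4
    have hτ0 : 0 ≠ τ := by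
      rintro rfl
      have : 4 * c 0 4 ≤ c 0 5 := hτ5
      linarith
    have hupto : ∀ t ∈ Icc 0 τ, c t 5 ≤ 4 * c t 4 := by
      rw [← closure_Ico hτ0]
      have hclosed : IsClosed {t | c t 5 ≤ 4 * c t 4} := isClosed_le (by fun_prop) (by fun_prop)
      exact closure_minimal hbefore hclosed
    have hf := (mem_setA2_of_hasDerivAt hm hθ hθ0 hc h0 hτ.1 hupto).1
    have : 4 * c τ 4 ≤ c τ 5 := hτ5
    linarith

theorem setS_subset_closedBall (hm : 1 ≤ m) : setS m ⊆ Metric.closedBall 0 2 := by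
  rintro p ⟨⟨⟨⟨-, hE⟩, hP⟩, -, h3⟩, hf, -, -, -⟩
  obtain ⟨-, hp4, hp5⟩ := id hP
  have hm' : (1 : ℝ) ≤ m := by exact_mod_cast hm
  have hRs := le_Rs hm hP h3 (by linarith)
  have hy : 3 * p 4 ^ 2 ≤ Rs m p := by nlinarith [sq_nonneg (p 4)]
  have hG : p 0 ^ 2 + p 1 ^ 2 + p 2 ^ 2 ≤ G m p := by
    unfold G; nlinarith [sq_nonneg (p 1), mul_nonneg (sub_nonneg.2 hm') (sq_nonneg (p 2)),
      sq_nonneg (p 2)]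
  have h4 : p 4 ≤ 1 := by nlinarith [sq_nonneg (p 0), sq_nonneg (p 1), sq_nonneg (p 2)]
  rw [mem_closedBall_zero_iff, pi_norm_le_iff_of_nonneg zero_le_two]
  intro i
  rw [Real.norm_eq_abs]
  fin_cases i
  · change |p 0| ≤ 2
    exact abs_le_of_sq_le_sq
      (by nlinarith [sq_nonneg (p 1), sq_nonneg (p 2), sq_nonneg (p 4)]) zero_le_two
  · change |p 1| ≤ 2
    exact abs_le_of_sq_le_sq
      (by nlinarith [sq_nonneg (p 0), sq_nonneg (p 2), sq_nonneg (p 4)]) zero_le_two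
  · change |p 2| ≤ 2
    exact abs_le_of_sq_le_sq
      (by nlinarith [sq_nonneg (p 0), sq_nonneg (p 1), sq_nonneg (p 4)]) zero_le_two
  · change |p 3| ≤ 2
    exact abs_le_of_sq_le_sq (by linarith) zero_le_two
  · change |p 4| ≤ 2
    exact abs_le.2 ⟨by linarith, by linarith⟩
  · change |p 5| ≤ 2
    exact abs_le.2 ⟨by linarith, by linarith⟩

end Curve

theorem stmt7 (m : ℕ) (hm : 1 ≤ m) (p : Fin 6 → ℝ) (hp : p ∈ setS m) :
    ∃ c : ℝ → Fin 6 → ℝ, c 0 = p ∧ IsSolution m (Set.Ici 0) c ∧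
      ∀ η ∈ Set.Ici (0:ℝ), c η ∈ setS m := by
  let χ : ContDiffBump (0 : Fin 6 → ℝ) := ⟨2, 3, by norm_num, by norm_num⟩
  have hWd : ContDiff ℝ 1 fun x ↦ χ x • V m x := χ.contDiff.smul (contDiff_V m)
  have hWs : HasCompactSupport fun x ↦ χ x • V m x := χ.hasCompactSupport.smul_right
  obtain ⟨K, hK⟩ := hWd.lipschitzWith_of_hasCompactSupport hWs one_ne_zero
  obtain ⟨M, hM⟩ := hWs.exists_bound_of_continuous hWd.continuous
  obtain ⟨c, hc0, hc⟩ := exists_forall_hasDerivAt_of_lipschitzWith hK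
    (M := M.toNNReal) (fun x ↦ (hM x).trans (Real.le_coe_toNNReal M)) p
  have hcc : Continuous c := continuous_iff_continuousAt.2 fun t ↦ (hc t).continuousAt
  have hS : ∀ η ∈ Ici (0 : ℝ), c η ∈ setS m := fun η hη ↦
    mem_setS_of_hasDerivAt (θ := fun t ↦ χ (c t)) hm (χ.continuous.comp hcc)
      (fun _ ↦ χ.nonneg) hc (hc0 ▸ hp) hη
  refine ⟨c, hc0, fun η hη ↦ ?_, hS⟩
  have h := hc η
  rw [χ.one_of_mem_closedBall (setS_subset_closedBall hm (hS η hη)), one_smul] at h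
  exact h.hasDerivWithinAt

end
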